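/- arXiv:1811.10751 — 10 statements merged into one kernel-verified Lean document; each statement's English description precedes it below -/
import Mathlib

section
/- Coefficient identity for Generalized PolyDot matrix-vector codes (core of Theorem 1): for every i = 0,…,m−1 and every row index r ∈ {0,…,a−1}, the coefficient of v^{n·i + n − 1} in the r-th entry of the product polynomial s̃(v) = W̃(v)·x̃(v) equals the r-th entry of s_i = ∑_{j=0}^{n−1} W_{i,j} x_j. -/
open Polynomial Matrix BigOperators

/-- Generalized PolyDot encoding of the block matrix `W` (after substitution `u = v^n`). -/
noncomputable def gpWTilde (m n a b : ℕ) (W : Fin m → Fin n → Matrix (Fin a) (Fin b) ℝ) :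
    Matrix (Fin a) (Fin b) (Polynomial ℝ) :=
  Matrix.of fun r c => ∑ i : Fin m, ∑ j : Fin n,
    Polynomial.C (W i j r c) * Polynomial.X ^ (n * (i : ℕ) + (j : ℕ))

/-- Generalized PolyDot encoding of the partitioned vector `x`. -/
noncomputable def gpXTilde (n b : ℕ) (x : Fin n → Fin b → ℝ) : Fin b → Polynomial ℝ :=
  fun c => ∑ j : Fin n, Polynomial.C (x j c) * Polynomial.X ^ (n - 1 - (j : ℕ))

/-- The product polynomial vector `s̃(v) = W̃(v) · x̃(v)`. -/
noncomputable def gpSTilde (m n a b : ℕ) (W : Fin m → Fin n → Matrix (Fin a) (Fin b) ℝ)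
    (x : Fin n → Fin b → ℝ) : Fin a → Polynomial ℝ :=
  Matrix.mulVec (gpWTilde m n a b W) (gpXTilde n b x)

theorem gp_exp_iff (n i i' j k : ℕ) (hj : j < n) (hk : k < n) :
    n * i + n - 1 = n * i' + j + (n - 1 - k) ↔ (i' = i ∧ j = k) := by
  constructor
  · intro h
    have h1 : n * i + k = n * i' + j := by omega
    have hn : 0 < n := by omega
    have h2 := congrArg (· / n) h1
    simp only [Nat.mul_add_div hn, Nat.div_eq_of_lt hj, Nat.div_eq_of_lt hk] at h2
    have h3 : i' = i := by omega
    subst h3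
    exact ⟨rfl, by omega⟩
  · rintro ⟨rfl, rfl⟩
    omega

/-- Coefficient identity for Generalized PolyDot matrix-vector codes: the coefficient of
`v^(n·i + n − 1)` in the `r`-th entry of `s̃(v)` equals the `r`-th entry of
`s_i = ∑_j W_{i,j} x_j`. -/
theorem stmt_0 (m n a b : ℕ) (hm : 0 < m) (hn : 0 < n) (ha : 0 < a) (hb : 0 < b)
    (W : Fin m → Fin n → Matrix (Fin a) (Fin b) ℝ) (x : Fin n → Fin b → ℝ)
    (i : Fin m) (r : Fin a) :
    (gpSTilde m n a b W x r).coeff (n * (i : ℕ) + n - 1)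
      = (∑ j : Fin n, Matrix.mulVec (W i j) (x j)) r := by
  have key : ∀ c : Fin b, (gpWTilde m n a b W r c * gpXTilde n b x c).coeff
      (n * (i : ℕ) + n - 1) = ∑ j : Fin n, W i j r c * x j c := by
    intro c
    simp only [gpWTilde, gpXTilde, Matrix.of_apply, Finset.sum_mul, Finset.mul_sum,
      Polynomial.finset_sum_coeff]
    have h : ∀ (i' : Fin m) (j k : Fin n),
        (Polynomial.C (W i' j r c) * Polynomial.X ^ (n * (i' : ℕ) + (j : ℕ)) *
          (Polynomial.C (x k c) * Polynomial.X ^ (n - 1 - (k : ℕ)))).coeff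
            (n * (i : ℕ) + n - 1)
          = if i' = i then (if j = k then W i' j r c * x k c else 0) else 0 := by
      intro i' j k
      rw [mul_mul_mul_comm, ← Polynomial.C_mul, ← pow_add, Polynomial.coeff_C_mul_X_pow]
      simp only [gp_exp_iff n i i' j k j.2 k.2, Fin.val_inj, ite_and]
    simp [h]
  simp only [gpSTilde, Matrix.mulVec, dotProduct, Polynomial.finset_sum_coeff, key,
    Finset.sum_apply]
  exact Finset.sum_comm
end

section
/- Recovery threshold of Generalized PolyDot matrix-vector codes (Theorem 1): let T = m·n + n − 1 and let b_0,…,b_{T−1} be pairwise distinct real numbers. If two block matrices and partitioned vectors (W, x) and (W′, x′) (with the same block dimensions) have encoded product polynomials s̃ and s̃′ satisfying s̃(b_p) = s̃′(b_p) for all p = 0,…,T−1, then for every i = 0,…,m−1, ∑_{j=0}^{n−1} W_{i,j} x_j = ∑_{j=0}^{n−1} W′_{i,j} x′_j. In particular, the desired matrix-vector product is determined by the evaluations of s̃ at any m·n + n − 1 distinct points. -/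
open Polynomial Matrix BigOperators

theorem gp_expand (m n a b : ℕ) (W : Fin m → Fin n → Matrix (Fin a) (Fin b) ℝ)
    (x : Fin n → Fin b → ℝ) (r : Fin a) :
    gpSTilde m n a b W x r = ∑ c : Fin b, ∑ i : Fin m, ∑ j : Fin n, ∑ k : Fin n,
      Polynomial.C (W i j r c * x k c) *
        Polynomial.X ^ (n * (i : ℕ) + (j : ℕ) + (n - 1 - (k : ℕ))) := by
  simp only [gpSTilde, Matrix.mulVec, dotProduct, gpWTilde, gpXTilde, Matrix.of_apply,
    Finset.sum_mul]
  simp only [Finset.mul_sum]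
  refine Finset.sum_congr rfl fun c _ => Finset.sum_congr rfl fun i _ =>
    Finset.sum_congr rfl fun j _ => Finset.sum_congr rfl fun k _ => ?_
  rw [Polynomial.C_mul, pow_add]
  ring

theorem gp_degree (m n a b : ℕ) (W : Fin m → Fin n → Matrix (Fin a) (Fin b) ℝ)
    (x : Fin n → Fin b → ℝ) (r : Fin a) :
    gpSTilde m n a b W x r ∈ Polynomial.degreeLT ℝ (m * n + n - 1) := by
  rw [gp_expand]
  refine Submodule.sum_mem _ fun c _ => Submodule.sum_mem _ fun i _ =>
    Submodule.sum_mem _ fun j _ => Submodule.sum_mem _ fun k _ => ?_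
  rw [Polynomial.mem_degreeLT]
  refine lt_of_le_of_lt (Polynomial.degree_C_mul_X_pow_le _ _) ?_
  have h1 : n * ((i : ℕ) + 1) ≤ n * m := Nat.mul_le_mul_left n i.2
  have hj := j.2
  have hk := k.2
  rw [mul_comm m n]
  rw [mul_add] at h1
  exact_mod_cast (by omega : n * (i : ℕ) + (j : ℕ) + (n - 1 - (k : ℕ)) < n * m + n - 1)

theorem gp_coeff (m n a b : ℕ) (W : Fin m → Fin n → Matrix (Fin a) (Fin b) ℝ)
    (x : Fin n → Fin b → ℝ) (r : Fin a) (i : Fin m) :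
    (gpSTilde m n a b W x r).coeff (n * (i : ℕ) + (n - 1)) =
      (∑ j : Fin n, Matrix.mulVec (W i j) (x j)) r := by
  have key : ∀ (i' : Fin m) (j k : Fin n),
      (n * (i : ℕ) + (n - 1) = n * (i' : ℕ) + (j : ℕ) + (n - 1 - (k : ℕ))) ↔
        (i = i' ∧ j = k) := by
    intro i' j k
    have hj := j.2
    have hk := k.2
    constructor
    · intro h
      have h2 : (k : ℕ) + n * (i : ℕ) = (j : ℕ) + n * (i' : ℕ) := by omega
      have hn : 0 < n := by omega
      have h3 := congrArg (· / n) h2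
      simp only [Nat.add_mul_div_left _ _ hn, Nat.div_eq_of_lt hj, Nat.div_eq_of_lt hk,
        zero_add] at h3
      refine ⟨Fin.ext h3, Fin.ext ?_⟩
      rw [h3] at h2
      omega
    · rintro ⟨rfl, rfl⟩
      omega
  rw [gp_expand]
  simp only [Polynomial.finsetSum_coeff, Polynomial.coeff_C_mul_X_pow, key, ite_and,
    Finset.sum_apply, Matrix.mulVec, dotProduct]
  rw [Finset.sum_comm]
  rw [Finset.sum_eq_single i]
  · simp only [if_true, Finset.sum_ite_eq, Finset.mem_univ]
    exact Finset.sum_comm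
  · intro i' _ hi
    simp [Ne.symm hi]
  · simp

/-- Recovery threshold of Generalized PolyDot matrix-vector codes (Theorem 1): with
`T = m·n + n − 1` pairwise distinct evaluation points, the evaluations of `s̃` determine
the desired products `s_i = ∑_j W_{i,j} x_j`. -/
theorem stmt_2 (m n a b : ℕ) (hm : 0 < m) (hn : 0 < n) (ha : 0 < a) (hb : 0 < b)
    (W W' : Fin m → Fin n → Matrix (Fin a) (Fin b) ℝ) (x x' : Fin n → Fin b → ℝ)
    (bp : Fin (m * n + n - 1) → ℝ) (hbp : Function.Injective bp)
    (heval : ∀ p : Fin (m * n + n - 1), ∀ r : Fin a,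
      (gpSTilde m n a b W x r).eval (bp p) = (gpSTilde m n a b W' x' r).eval (bp p)) :
    ∀ i : Fin m,
      (∑ j : Fin n, Matrix.mulVec (W i j) (x j))
        = ∑ j : Fin n, Matrix.mulVec (W' i j) (x' j) := by
  intro i
  funext r
  rw [← gp_coeff, ← gp_coeff]
  congr 1
  have hdeg := fun W x => Polynomial.mem_degreeLT.mp (gp_degree m n a b W x r)
  refine Polynomial.eq_of_degrees_lt_of_eval_index_eq Finset.univ (v := bp) hbp.injOn
    ?_ ?_ (fun p _ => heval p r)
  · simpa using hdeg W x
  · simpa using hdeg W' x'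
end

section
/- Coefficient identity for Generalized PolyDot matrix-matrix codes (core of Theorem 2): for every i = 0,…,m−1, every k = 0,…,d−1, and every entry position (r, c) with r ∈ {0,…,a−1} and c ∈ {0,…,e−1}, the coefficient of v^{n·i + m·n·k + n − 1} in the (r,c) entry of the product polynomial matrix S̃(v) = W̃(v)·X̃(v) equals the (r,c) entry of S_{i,k} = ∑_{j=0}^{n−1} W_{i,j} X_{j,k}. -/
open Polynomial Matrix BigOperators

/-- Generalized PolyDot encoding of the block matrix `W` (after substitutions
`u = v^n`, `w = v^(m·n)`). -/
noncomputable def gpmWTilde (m n a b : ℕ) (W : Fin m → Fin n → Matrix (Fin a) (Fin b) ℝ) :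
    Matrix (Fin a) (Fin b) (Polynomial ℝ) :=
  Matrix.of fun r c => ∑ i : Fin m, ∑ j : Fin n,
    Polynomial.C (W i j r c) * Polynomial.X ^ (n * (i : ℕ) + (j : ℕ))

/-- Generalized PolyDot encoding of the block matrix `X`. -/
noncomputable def gpmXTilde (m n d b e : ℕ) (X : Fin n → Fin d → Matrix (Fin b) (Fin e) ℝ) :
    Matrix (Fin b) (Fin e) (Polynomial ℝ) :=
  Matrix.of fun c s => ∑ j : Fin n, ∑ k : Fin d,
    Polynomial.C (X j k c s) * Polynomial.X ^ ((n - 1 - (j : ℕ)) + m * n * (k : ℕ))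

/-- The product polynomial matrix `S̃(v) = W̃(v)·X̃(v)`. -/
noncomputable def gpmSTilde (m n d a b e : ℕ)
    (W : Fin m → Fin n → Matrix (Fin a) (Fin b) ℝ)
    (X : Fin n → Fin d → Matrix (Fin b) (Fin e) ℝ) :
    Matrix (Fin a) (Fin e) (Polynomial ℝ) :=
  gpmWTilde m n a b W * gpmXTilde m n d b e X

theorem gpm_key (m n : ℕ) (i i' j j' k k' : ℕ) (hi : i < m) (hi' : i' < m)
    (hj : j < n) (hj' : j' < n) :
    (n * i + m * n * k + n - 1 = n * i' + j' + (n - 1 - j + m * n * k')) ↔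
      (i' = i ∧ k' = k ∧ j' = j) := by
  constructor
  · intro h
    have h1 : n * (i + m * k) + j = n * (i' + m * k') + j' := by
      have e1 : n * (i + m * k) = n * i + m * n * k := by ring
      have e2 : n * (i' + m * k') = n * i' + m * n * k' := by ring
      omega
    have hjj : j = j' := by
      have := congrArg (· % n) h1
      simpa [Nat.mul_add_mod, Nat.mod_eq_of_lt hj, Nat.mod_eq_of_lt hj'] using this
    have h2 : i + m * k = i' + m * k' := by
      apply Nat.eq_of_mul_eq_mul_left (show 0 < n by omega)
      omega
    have hii : i = i' := by
      have := congrArg (· % m) h2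
      simpa [Nat.add_mul_mod_self_left, Nat.mod_eq_of_lt hi, Nat.mod_eq_of_lt hi'] using this
    have hkk : k = k' := by
      apply Nat.eq_of_mul_eq_mul_left (show 0 < m by omega)
      omega
    exact ⟨hii.symm, hkk.symm, hjj.symm⟩
  · rintro ⟨rfl, rfl, rfl⟩
    omega

/-- Coefficient identity for Generalized PolyDot matrix-matrix codes: the coefficient of
`v^(n·i + m·n·k + n − 1)` in the `(r,c)` entry of `S̃(v)` equals the `(r,c)` entry of
`S_{i,k} = ∑_j W_{i,j} X_{j,k}`. -/
theorem stmt_3 (m n d a b e : ℕ) (hm : 0 < m) (hn : 0 < n) (hd : 0 < d)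
    (ha : 0 < a) (hb : 0 < b) (he : 0 < e)
    (W : Fin m → Fin n → Matrix (Fin a) (Fin b) ℝ)
    (X : Fin n → Fin d → Matrix (Fin b) (Fin e) ℝ)
    (i : Fin m) (k : Fin d) (r : Fin a) (c : Fin e) :
    (gpmSTilde m n d a b e W X r c).coeff (n * (i : ℕ) + m * n * (k : ℕ) + n - 1)
      = (∑ j : Fin n, W i j * X j k) r c := by
  have key : ∀ (p q : ℝ) (i' : Fin m) (j' j : Fin n) (k' : Fin d),
      ((C p * Polynomial.X ^ (n * (i' : ℕ) + (j' : ℕ))) *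
        (C q * Polynomial.X ^ ((n - 1 - (j : ℕ)) + m * n * (k' : ℕ))) : Polynomial ℝ).coeff
          (n * (i : ℕ) + m * n * (k : ℕ) + n - 1)
      = if i' = i then (if k' = k then (if j' = j then p * q else 0) else 0) else 0 := by
    intro p q i' j' j k'
    rw [mul_mul_mul_comm, ← C_mul, ← pow_add, coeff_C_mul_X_pow]
    simp only [gpm_key m n i i' j j' k k' i.2 i'.2 j.2 j'.2, Fin.val_inj, ite_and]
  simp only [gpmSTilde, gpmWTilde, gpmXTilde, Matrix.mul_apply, Matrix.of_apply,
    Finset.sum_mul_sum, Finset.sum_mul, Finset.mul_sum, finset_sum_coeff, key,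
    Matrix.sum_apply]
  rw [Finset.sum_comm]
  simp
end

section
/- Recovery threshold of Generalized PolyDot matrix-matrix codes (Theorem 2): let T = m·n·d + n − 1 and let b_0,…,b_{T−1} be pairwise distinct real numbers. If two pairs of block-partitioned matrices (W, X) and (W′, X′) (with the same block dimensions) have encoded product polynomial matrices S̃ and S̃′ satisfying S̃(b_p) = S̃′(b_p) for all p = 0,…,T−1, then for every i = 0,…,m−1 and k = 0,…,d−1, ∑_{j=0}^{n−1} W_{i,j} X_{j,k} = ∑_{j=0}^{n−1} W′_{i,j} X′_{j,k}. In particular, the desired matrix-matrix product is determined by the evaluations of S̃ at any m·n·d + n − 1 distinct points. -/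
open Polynomial Matrix BigOperators

theorem gpm_expand (m n d a b e : ℕ)
    (W : Fin m → Fin n → Matrix (Fin a) (Fin b) ℝ)
    (X : Fin n → Fin d → Matrix (Fin b) (Fin e) ℝ) (r : Fin a) (s : Fin e) :
    gpmSTilde m n d a b e W X r s = ∑ c : Fin b, ∑ i : Fin m, ∑ j : Fin n, ∑ j' : Fin n,
      ∑ k : Fin d, Polynomial.C (W i j r c * X j' k c s) * Polynomial.X ^
        ((n * (i : ℕ) + (j : ℕ)) + ((n - 1 - (j' : ℕ)) + m * n * (k : ℕ))) := by
  simp only [gpmSTilde, gpmWTilde, gpmXTilde, Matrix.mul_apply, Matrix.of_apply]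
  simp only [Finset.sum_mul]
  simp only [Finset.mul_sum]
  refine Finset.sum_congr rfl fun c _ => ?_
  have h : ∀ (i : Fin m) (j j' : Fin n) (k : Fin d),
      Polynomial.C (W i j r c) * Polynomial.X ^ (n * (i : ℕ) + (j : ℕ)) *
        (Polynomial.C (X j' k c s) * Polynomial.X ^ ((n - 1 - (j' : ℕ)) + m * n * (k : ℕ))) =
      Polynomial.C (W i j r c * X j' k c s) * Polynomial.X ^
        ((n * (i : ℕ) + (j : ℕ)) + ((n - 1 - (j' : ℕ)) + m * n * (k : ℕ))) := by
    intro i j j' k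
    rw [pow_add _ (n * (i : ℕ) + (j : ℕ)), Polynomial.C_mul]
    ring
  simp only [h]

theorem gpm_exp_lt {m n d : ℕ} (i : Fin m) (j j' : Fin n) (k : Fin d) :
    (n * (i : ℕ) + (j : ℕ)) + ((n - 1 - (j' : ℕ)) + m * n * (k : ℕ)) < m * n * d + n - 1 := by
  have h1 : n * ((i : ℕ) + 1) ≤ n * m := Nat.mul_le_mul_left _ i.2
  have h2 : m * n * ((k : ℕ) + 1) ≤ m * n * d := Nat.mul_le_mul_left _ k.2
  have := j.2
  have := j'.2
  have h3 : n * m = m * n := mul_comm _ _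
  rw [mul_add] at h1 h2
  omega

theorem gpm_exp_inj {m n d : ℕ} (i i0 : Fin m) (j j' : Fin n) (k k0 : Fin d) :
    (n * (i0 : ℕ) + (n - 1) + m * n * (k0 : ℕ) =
      (n * (i : ℕ) + (j : ℕ)) + ((n - 1 - (j' : ℕ)) + m * n * (k : ℕ))) ↔
    (i = i0 ∧ j' = j ∧ k = k0) := by
  have hj := j.2
  have hj' := j'.2
  constructor
  · intro h
    have h1 : n * ((i0 : ℕ) + m * k0) + j' = n * ((i : ℕ) + m * k) + j := by
      have e1 : n * ((i0 : ℕ) + m * k0) = n * i0 + m * n * k0 := by ring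
      have e2 : n * ((i : ℕ) + m * k) = n * i + m * n * k := by ring
      omega
    have h2 : (j' : ℕ) = j := by
      have := congrArg (· % n) h1
      simpa [Nat.mul_add_mod, Nat.mod_eq_of_lt hj, Nat.mod_eq_of_lt hj'] using this
    have h3 : (i0 : ℕ) + m * k0 = (i : ℕ) + m * k := by
      rw [h2] at h1
      exact Nat.eq_of_mul_eq_mul_left (by omega) (Nat.add_right_cancel h1)
    have h4 : (i0 : ℕ) = i := by
      have := congrArg (· % m) h3
      simpa [Nat.add_mul_mod_self_left, Nat.mod_eq_of_lt i.2, Nat.mod_eq_of_lt i0.2] using this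
    have h5 : (k0 : ℕ) = k := by
      rw [h4] at h3
      have := i.2
      exact Nat.eq_of_mul_eq_mul_left (by omega) (Nat.add_left_cancel h3)
    exact ⟨Fin.ext h4.symm, Fin.ext h2, Fin.ext h5.symm⟩
  · rintro ⟨rfl, rfl, rfl⟩
    omega

theorem gpm_coeff (m n d a b e : ℕ)
    (W : Fin m → Fin n → Matrix (Fin a) (Fin b) ℝ)
    (X : Fin n → Fin d → Matrix (Fin b) (Fin e) ℝ) (r : Fin a) (s : Fin e)
    (i0 : Fin m) (k0 : Fin d) :
    (gpmSTilde m n d a b e W X r s).coeff (n * (i0 : ℕ) + (n - 1) + m * n * (k0 : ℕ)) =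
      (∑ j : Fin n, W i0 j * X j k0) r s := by
  rw [gpm_expand]
  simp only [Polynomial.finsetSum_coeff, Polynomial.coeff_C_mul_X_pow, gpm_exp_inj, ite_and]
  simp only [Matrix.sum_apply, Matrix.mul_apply]
  rw [Finset.sum_comm]
  rw [Finset.sum_comm]
  rw [Finset.sum_comm (s := (Finset.univ : Finset (Fin n)))]
  refine Finset.sum_congr rfl fun c _ => ?_
  rw [Finset.sum_eq_single i0 (by intro i _ hi; simp [hi]) (by simp)]
  refine Finset.sum_congr rfl fun j _ => ?_
  simp

theorem gpm_degree (m n d a b e : ℕ)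
    (W : Fin m → Fin n → Matrix (Fin a) (Fin b) ℝ)
    (X : Fin n → Fin d → Matrix (Fin b) (Fin e) ℝ) (r : Fin a) (s : Fin e) :
    gpmSTilde m n d a b e W X r s ∈ Polynomial.degreeLT ℝ (m * n * d + n - 1) := by
  rw [gpm_expand]
  refine Submodule.sum_mem _ fun c _ => Submodule.sum_mem _ fun i _ => Submodule.sum_mem _ fun j _ =>
    Submodule.sum_mem _ fun j' _ => Submodule.sum_mem _ fun k _ => ?_
  rw [Polynomial.mem_degreeLT]
  exact (Polynomial.degree_C_mul_X_pow_le _ _).trans_lt (by exact_mod_cast gpm_exp_lt i j j' k)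

/-- Recovery threshold of Generalized PolyDot matrix-matrix codes (Theorem 2): with
`T = m·n·d + n − 1` pairwise distinct evaluation points, the evaluations of `S̃` determine
the desired products `S_{i,k} = ∑_j W_{i,j} X_{j,k}`. -/
theorem stmt_5 (m n d a b e : ℕ) (hm : 0 < m) (hn : 0 < n) (hd : 0 < d)
    (ha : 0 < a) (hb : 0 < b) (he : 0 < e)
    (W W' : Fin m → Fin n → Matrix (Fin a) (Fin b) ℝ)
    (X X' : Fin n → Fin d → Matrix (Fin b) (Fin e) ℝ)
    (bp : Fin (m * n * d + n - 1) → ℝ) (hbp : Function.Injective bp)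
    (heval : ∀ p : Fin (m * n * d + n - 1), ∀ (r : Fin a) (c : Fin e),
      (gpmSTilde m n d a b e W X r c).eval (bp p)
        = (gpmSTilde m n d a b e W' X' r c).eval (bp p)) :
    ∀ (i : Fin m) (k : Fin d),
      (∑ j : Fin n, W i j * X j k) = ∑ j : Fin n, W' i j * X' j k := by
  intro i k
  ext r s
  rw [← gpm_coeff, ← gpm_coeff]
  congr 1
  refine Polynomial.eq_of_degrees_lt_of_eval_index_eq Finset.univ
    (v := bp) (hbp.injOn) ?_ ?_ (fun p _ => heval p r s)
  · simpa using Polynomial.mem_degreeLT.1 (gpm_degree m n d a b e W X r s)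
  · simpa using Polynomial.mem_degreeLT.1 (gpm_degree m n d a b e W' X' r s)
end

section
/- Error detection with probability 1 under the probabilistic error model (Claim 1 of Theorem 3): let H ∈ ℝ^{r×P} have the MDS parity-check property and let A ⊆ {0,…,P−1} be nonempty. Then μ_A({ε : H · e(ε) = 0}) = 0; that is, almost surely the syndrome H · e(ε) is nonzero, so the occurrence of errors is detected with probability 1. -/
open MeasureTheory ProbabilityTheory BigOperators

/-- `H` has the MDS parity-check property: every `r` of its columns are linearly
independent. -/
def MDSParityCheck (r P : ℕ) (H : Matrix (Fin r) (Fin P) ℝ) : Prop :=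
  ∀ s : Finset (Fin P), s.card = r →
    LinearIndependent ℝ (fun j : s => fun i : Fin r => H i (j : Fin P))

/-- The random error vector `e(ε)`: entries indexed by `A` are given by `ε`, the rest are 0. -/
noncomputable def errVec (P : ℕ) (A : Finset (Fin P)) (ε : A → ℝ) : Fin P → ℝ :=
  fun i => if h : i ∈ A then ε ⟨i, h⟩ else 0

/-- The law `μ_A`: product over `i ∈ A` of standard Gaussian measures on ℝ. -/
noncomputable def gaussPi (P : ℕ) (A : Finset (Fin P)) : Measure (A → ℝ) :=
  Measure.pi fun _ => gaussianReal 0 1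

theorem hyper_null {ι : Type} [Fintype ι] [DecidableEq ι] (c : ι → ℝ) (a : ι) (ha : c a ≠ 0) :
    (Measure.pi fun _ : ι => gaussianReal 0 1) {ε | ∑ i, c i * ε i = 0} = 0 := by
  have hN : NullSingletonClass (gaussianReal 0 1) := nullSingletonClass_gaussianReal one_ne_zero
  have hm : MeasurableSet {ε : ι → ℝ | ∑ i, c i * ε i = 0} :=
    measurableSet_eq_fun (by fun_prop) (by fun_prop)
  have mp := (measurePreserving_piEquivPiSubtypeProd (fun _ : ι => gaussianReal 0 1)
    (fun i => i ≠ a)).symm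
  rw [← mp.measure_preimage hm.nullMeasurableSet,
    Measure.measure_prod_null (mp.measurable hm)]
  refine Filter.Eventually.of_forall fun y => ?_
  refine measure_mono_null (t := {x | x ⟨a, not_not.mpr rfl⟩ =
    - (∑ i ∈ Finset.univ.erase a, c i * (if h : i ≠ a then y ⟨i, h⟩ else 0)) / c a}) ?_
    (Measure.pi_hyperplane (fun _ => gaussianReal 0 1) _ _)
  intro x hx
  simp only [Set.mem_preimage, Set.mem_ofPred_eq] at hx ⊢
  rw [← Finset.add_sum_erase _ _ (Finset.mem_univ a)] at hx
  have h1 : ∀ i ∈ Finset.univ.erase a, c i * (MeasurableEquiv.piEquivPiSubtypeProd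
      (fun _ : ι => ℝ) (fun i => i ≠ a)).symm (y, x) i =
      c i * (if h : i ≠ a then y ⟨i, h⟩ else 0) := by
    intro i hi
    have := Finset.ne_of_mem_erase hi
    simp [MeasurableEquiv.piEquivPiSubtypeProd, Equiv.piEquivPiSubtypeProd, this]
  have h2 : (MeasurableEquiv.piEquivPiSubtypeProd
      (fun _ : ι => ℝ) (fun i => i ≠ a)).symm (y, x) a = x ⟨a, not_not.mpr rfl⟩ := by
    simp [MeasurableEquiv.piEquivPiSubtypeProd, Equiv.piEquivPiSubtypeProd]
  rw [Finset.sum_congr rfl h1, h2] at hx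
  rw [eq_div_iff ha]
  linarith

/-- Error detection with probability 1 under the probabilistic error model (Claim 1 of
Theorem 3): for nonempty `A`, almost surely the syndrome `H · e(ε)` is nonzero. -/
theorem stmt_6 (r P : ℕ) (hr : 0 < r) (hrP : r < P)
    (H : Matrix (Fin r) (Fin P) ℝ) (hH : MDSParityCheck r P H)
    (A : Finset (Fin P)) (hA : A.Nonempty) :
    gaussPi P A {ε | H.mulVec (errVec P A ε) = 0} = 0 := by
  obtain ⟨a, ha⟩ := hA
  obtain ⟨s, hs, hsc⟩ := Finset.exists_superset_card_eq (s := {a}) (n := r)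
    (by rw [Finset.card_singleton]; exact hr) (by simpa using hrP.le)
  have hne := (hH s hsc).ne_zero ⟨a, hs (Finset.mem_singleton_self a)⟩
  obtain ⟨k, hk⟩ := Function.ne_iff.mp hne
  refine measure_mono_null ?_ (hyper_null (fun i : A => H k i) ⟨a, ha⟩ hk)
  intro ε hε
  have h := congrFun hε k
  simp only [Matrix.mulVec, dotProduct, Pi.zero_apply] at h
  simp only [Set.mem_ofPred_eq]
  rw [← h, ← Finset.sum_subset (Finset.subset_univ A), ← Finset.sum_coe_sort A]
  · refine Finset.sum_congr rfl fun i _ => ?_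
    simp [errVec]
  · intro i _ hi
    simp [errVec, hi]
end

section
/- Almost-sure uniqueness of the minimum-support error explanation (Claims 2–3 of Theorem 3, key step): let H ∈ ℝ^{r×P} have the MDS parity-check property and let A ⊆ {0,…,P−1} be any subset. Then μ_A({ε : there exists e′ ∈ ℝ^P with e′ ≠ e(ε), H·e′ = H·e(ε), and ‖e′‖₀ ≤ min(|A|, r − 1)}) = 0. Consequently, if |A| ≤ r − 1 then almost surely e(ε) is the unique vector of minimal support consistent with the syndrome H·e(ε), so up to r − 1 errors are corrected with probability 1. -/
open MeasureTheory ProbabilityTheory BigOperators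

theorem aux_inj (r P : ℕ) (hrP : r < P)
    (H : Matrix (Fin r) (Fin P) ℝ) (hH : MDSParityCheck r P H)
    (T : Finset (Fin P)) (hT : T.card ≤ r) (z : Fin P → ℝ) (hz : ∀ j, j ∉ T → z j = 0)
    (h : H.mulVec z = 0) : z = 0 := by
  obtain ⟨S, hTS, hS⟩ := Finset.exists_superset_card_eq hT (by simpa using hrP.le)
  have hli := Fintype.linearIndependent_iff.1 (hH S hS) (fun j => z j) (by
    ext i
    have h1 := congrFun h i
    simp only [Matrix.mulVec, dotProduct, Pi.zero_apply] at h1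
    rw [Finset.sum_apply, Pi.zero_apply, ← h1]
    simp only [Pi.smul_apply, smul_eq_mul]
    rw [Finset.sum_coe_sort S (fun j => z j * H i j)]
    rw [Finset.sum_subset (Finset.subset_univ S)]
    · exact Finset.sum_congr rfl fun j _ => mul_comm _ _
    · intro j _ hj
      rw [hz j (fun h => hj (hTS h)), zero_mul])
  ext j
  by_cases hj : j ∈ S
  · exact hli ⟨j, hj⟩
  · exact hz j (fun h => hj (hTS h))

theorem aux_null {ι : Type*} [Fintype ι] [DecidableEq ι] (V : Submodule ℝ (ι → ℝ)) (i : ι)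
    (hi : Pi.single i 1 ∉ V) : Measure.pi (fun _ : ι => gaussianReal 0 1) (V : Set (ι → ℝ)) = 0 := by
  have hm : MeasurableSet (V : Set (ι → ℝ)) := V.closed_of_finiteDimensional.measurableSet
  have hf : Measurable ((V : Set (ι → ℝ)).indicator (fun _ => (1 : ENNReal))) :=
    measurable_const.indicator hm
  rw [← lintegral_indicator_one hm]
  change ∫⁻ a, (V : Set (ι → ℝ)).indicator (fun _ => (1 : ENNReal)) a ∂_ = 0
  rw [lintegral_eq_lmarginal_univ (0 : ι → ℝ),
    lmarginal_erase' _ hf (Finset.mem_univ i)]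
  have : (fun x : ι → ℝ => ∫⁻ t, (V : Set (ι → ℝ)).indicator (fun _ => (1 : ENNReal))
      (Function.update x i t) ∂(gaussianReal 0 1)) = fun _ => 0 := by
    ext x
    have hs : (Function.update x i ⁻¹' (V : Set (ι → ℝ))).Subsingleton := by
      intro t ht s hs
      by_contra hne
      apply hi
      have h := V.smul_mem (t - s)⁻¹ (V.sub_mem ht hs)
      convert h using 1
      ext j
      by_cases hj : j = i
      · subst hj
        simp [inv_mul_cancel₀ (sub_ne_zero.2 hne)]
      · simp [hj]
    have : NullSingletonClass (gaussianReal 0 1) := nullSingletonClass_gaussianReal one_ne_zero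
    have h0 := hs.measure_zero (gaussianReal 0 1)
    rw [← lintegral_indicator_one (hm.preimage (measurable_update x))] at h0
    exact h0
  rw [this]
  simp [lmarginal]

theorem aux_single (P : ℕ) (A : Finset (Fin P)) (i : A) :
    errVec P A (Pi.single i 1) = Pi.single (i : Fin P) 1 := by
  ext j
  unfold errVec
  by_cases hj : j = i
  · subst hj; simp
  · by_cases hA : j ∈ A
    · have : (⟨j, hA⟩ : A) ≠ i := fun h => hj (congrArg Subtype.val h)
      simp [hA, hj, this]
    · simp [hA, hj]

/-- the bad subspace -/
def badV (r P : ℕ) (H : Matrix (Fin r) (Fin P) ℝ) (A T : Finset (Fin P)) :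
    Submodule ℝ (A → ℝ) where
  carrier := {ε | ∃ e' : Fin P → ℝ, (∀ j, j ∉ T → e' j = 0) ∧
    H.mulVec e' = H.mulVec (errVec P A ε)}
  zero_mem' := ⟨0, fun _ _ => rfl, by
    congr 1; ext j; simp [errVec]⟩
  add_mem' := by
    rintro a b ⟨x, hx, hx'⟩ ⟨y, hy, hy'⟩
    refine ⟨x + y, fun j hj => by simp [hx j hj, hy j hj], ?_⟩
    rw [Matrix.mulVec_add, hx', hy', ← Matrix.mulVec_add]
    congr 1; ext j; by_cases h : j ∈ A <;> simp [errVec, h]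
  smul_mem' := by
    rintro c a ⟨x, hx, hx'⟩
    refine ⟨c • x, fun j hj => by simp [hx j hj], ?_⟩
    rw [Matrix.mulVec_smul, hx', ← Matrix.mulVec_smul]
    congr 1; ext j; by_cases h : j ∈ A <;> simp [errVec, h]

/-- Almost-sure uniqueness of the minimum-support error explanation (Claims 2–3 of
Theorem 3, key step): with probability 1 there is no other vector `e′ ≠ e(ε)` with the
same syndrome and support size at most `min(|A|, r − 1)`. -/
theorem stmt_7 (r P : ℕ) (hr : 0 < r) (hrP : r < P)
    (H : Matrix (Fin r) (Fin P) ℝ) (hH : MDSParityCheck r P H)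
    (A : Finset (Fin P)) :
    gaussPi P A {ε | ∃ e' : Fin P → ℝ, e' ≠ errVec P A ε ∧
      H.mulVec e' = H.mulVec (errVec P A ε) ∧
      hammingNorm e' ≤ min A.card (r - 1)} = 0 := by
  classical
  have key : ∀ T : Finset (Fin P), gaussPi P A {ε | T.card ≤ min A.card (r - 1) ∧
      ∃ e' : Fin P → ℝ, e' ≠ errVec P A ε ∧
      H.mulVec e' = H.mulVec (errVec P A ε) ∧ ∀ j, j ∉ T → e' j = 0} = 0 := by
    intro T
    by_cases hT : T.card ≤ min A.card (r - 1)
    swap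
    · simp [hT]
    have hTA := hT.trans (min_le_left _ _)
    have hTr := hT.trans (min_le_right _ _)
    by_cases hAT : A ⊆ T
    · have hEq : A = T := Finset.eq_of_subset_of_card_le hAT hTA
      subst hEq
      convert measure_empty (μ := gaussPi P A)
      ext ε
      simp only [Set.mem_ofPred_eq, Set.mem_empty_iff_false, iff_false]
      rintro ⟨-, e', hne, hs, h0⟩
      apply hne
      rw [← sub_eq_zero]
      refine aux_inj r P hrP H hH A (by omega) _ (fun j hj => ?_) ?_
      · simp [h0 j hj, errVec, hj]
      · rw [Matrix.mulVec_sub, hs, sub_self]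
    · obtain ⟨i, hiA, hiT⟩ := Finset.not_subset.1 hAT
      refine measure_mono_null ?_ (aux_null (badV r P H A T) ⟨i, hiA⟩ ?_)
      · rintro ε ⟨-, e', -, hs, h0⟩
        exact ⟨e', h0, hs⟩
      · rintro ⟨e', h0, hs⟩
        rw [aux_single] at hs
        have h := aux_inj r P hrP H hH (insert i T)
          ((Finset.card_insert_le _ _).trans (by omega)) (e' - Pi.single i 1)
          (fun j hj => by
            rw [Finset.mem_insert, not_or] at hj
            simp [h0 j hj.2, hj.1])
          (by rw [Matrix.mulVec_sub, hs, sub_self])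
        have h2 := congrFun h i
        simp [h0 i hiT] at h2
  refine measure_mono_null ?_ (measure_iUnion_null key)
  rintro ε ⟨e', hne, hs, hc⟩
  refine Set.mem_iUnion.2 ⟨Finset.univ.filter (fun j => e' j ≠ 0), ?_, e', hne, hs, ?_⟩
  · simpa [hammingNorm] using hc
  · intro j hj
    simpa using hj
end

section
/- Almost-sure decoding failure detection under too many errors (Claim 3 of Theorem 3): let H ∈ ℝ^{r×P} have the MDS parity-check property and let A ⊆ {0,…,P−1} satisfy |A| ≥ r. Then μ_A({ε : there exists e′ ∈ ℝ^P with H·e′ = H·e(ε) and ‖e′‖₀ ≤ r − 1}) = 0; that is, with probability 1 no vector of support size at most r − 1 is consistent with the observed syndrome, so the decoder declares a decoding failure with probability 1. -/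
open MeasureTheory ProbabilityTheory BigOperators

lemma pi_gauss_submodule {ι : Type*} [Fintype ι] (V : Submodule ℝ (ι → ℝ)) (hV : V ≠ ⊤) :
    (Measure.pi fun _ : ι => gaussianReal 0 1) (V : Set (ι → ℝ)) = 0 := by
  obtain ⟨f, hf, hVf⟩ := Submodule.exists_le_ker_of_lt_top V (lt_top_iff_ne_top.2 hV)
  let L : StrongDual ℝ (EuclideanSpace ℝ ι) :=
    LinearMap.toContinuousLinearMap (f ∘ₗ (WithLp.linearEquiv 2 ℝ (ι → ℝ)).toLinearMap)
  have hL : ∀ x, L (WithLp.toLp 2 x) = f x := fun x => rfl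
  have hL0 : L ≠ 0 := by
    intro h
    apply hf
    refine LinearMap.ext fun x => ?_
    simp [← hL, h]
  have h1 := IsGaussian.map_eq_gaussianReal (μ := stdGaussian (EuclideanSpace ℝ ι)) L
  rw [variance_dual_stdGaussian] at h1
  have hv : (‖L‖ ^ 2).toNNReal ≠ 0 := by
    have : 0 < ‖L‖ := norm_pos_iff.2 hL0
    simp only [ne_eq, Real.toNNReal_eq_zero, not_le]
    positivity
  have := nullSingletonClass_gaussianReal (μ := (stdGaussian (EuclideanSpace ℝ ι))[L]) hv
  have h2 : (stdGaussian (EuclideanSpace ℝ ι)).map L {0} = 0 := by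
    rw [h1]; exact measure_singleton _
  rw [Measure.map_apply L.continuous.measurable (measurableSet_singleton _),
    ← map_pi_eq_stdGaussian, Measure.map_apply (by fun_prop)
      (L.continuous.measurable (measurableSet_singleton _))] at h2
  refine measure_mono_null (fun x hx => ?_) h2
  have := hVf hx
  simpa [hL] using this

/-- The error embedding as a linear map. -/
noncomputable def errLin (P : ℕ) (A : Finset (Fin P)) : (A → ℝ) →ₗ[ℝ] (Fin P → ℝ) where
  toFun := errVec P A
  map_add' x y := by ext i; by_cases h : i ∈ A <;> simp [errVec, h]
  map_smul' c x := by ext i; by_cases h : i ∈ A <;> simp [errVec, h]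

lemma comap_ne_top (r P : ℕ) (hr : 0 < r)
    (H : Matrix (Fin r) (Fin P) ℝ) (hH : MDSParityCheck r P H)
    (A : Finset (Fin P)) (hA : r ≤ A.card) (T : Finset (Fin P)) (hT : T.card ≤ r - 1) :
    (Submodule.span ℝ (T.image H.col : Set (Fin r → ℝ))).comap
      (H.mulVecLin ∘ₗ errLin P A) ≠ ⊤ := by
  classical
  intro h
  obtain ⟨s, hsA, hs⟩ := Finset.exists_subset_card_eq hA
  have hli := hH s hs
  have hc := finrank_span_eq_card hli
  rw [Fintype.card_coe, hs] at hc
  have h1 : Module.finrank ℝ (Submodule.span ℝ (T.image H.col : Set (Fin r → ℝ))) ≤ r - 1 :=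
    (finrank_span_finset_le_card _).trans (Finset.card_image_le.trans hT)
  have h2 : Submodule.span ℝ (Set.range (fun j : s => fun i : Fin r => H i (j : Fin P))) ≤
      Submodule.span ℝ (T.image H.col : Set (Fin r → ℝ)) := by
    rw [Submodule.span_le]
    rintro _ ⟨j, rfl⟩
    have hj : (Pi.single ⟨j, hsA j.2⟩ 1 : A → ℝ) ∈ (⊤ : Submodule ℝ (A → ℝ)) := trivial
    rw [← h, Submodule.mem_comap] at hj
    have he : errLin P A (Pi.single ⟨j, hsA j.2⟩ 1) = Pi.single (j : Fin P) 1 := by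
      ext i
      by_cases hi : i ∈ A
      · simp [errLin, errVec, hi, Pi.single_apply]
      · have : i ≠ j := fun h => hi (h ▸ hsA j.2)
        simp [errLin, errVec, hi, this]
    rw [LinearMap.comp_apply, he, Matrix.mulVecLin_apply, Matrix.mulVec_single_one] at hj
    exact hj
  have h3 := Submodule.finrank_mono h2
  omega

/-- Almost-sure decoding failure detection under too many errors (Claim 3 of Theorem 3):
if `|A| ≥ r`, then with probability 1 no vector of support size at most `r − 1` is
consistent with the observed syndrome. -/
theorem stmt_8 (r P : ℕ) (hr : 0 < r) (hrP : r < P)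
    (H : Matrix (Fin r) (Fin P) ℝ) (hH : MDSParityCheck r P H)
    (A : Finset (Fin P)) (hA : r ≤ A.card) :
    gaussPi P A {ε | ∃ e' : Fin P → ℝ,
      H.mulVec e' = H.mulVec (errVec P A ε) ∧ hammingNorm e' ≤ r - 1} = 0 := by
  classical
  have key : gaussPi P A (⋃ T : {T : Finset (Fin P) // T.card ≤ r - 1},
      ((Submodule.span ℝ (T.1.image H.col : Set (Fin r → ℝ))).comap
      (H.mulVecLin ∘ₗ errLin P A) : Set (A → ℝ))) = 0 :=
    measure_iUnion_null fun T => pi_gauss_submodule _ (comap_ne_top r P hr H hH A hA T.1 T.2)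
  refine measure_mono_null ?_ key
  rintro ε ⟨e', he, hn⟩
  refine Set.mem_iUnion.2 ⟨⟨Finset.univ.filter (fun i => e' i ≠ 0), hn⟩, ?_⟩
  change H.mulVec (errVec P A ε) ∈ Submodule.span ℝ _
  rw [← he, Matrix.mulVec_eq_sum]
  refine Submodule.sum_mem _ fun i _ => ?_
  by_cases hi : e' i = 0
  · simp [hi]
  · have hm : H.col i ∈ Submodule.span ℝ
        (((Finset.univ.filter (fun i => e' i ≠ 0)).image H.col : Finset _) : Set (Fin r → ℝ)) :=
      Submodule.subset_span (Finset.mem_coe.2 (Finset.mem_image_of_mem _ (by simp [hi])))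
    rw [op_smul_eq_smul]
    exact Submodule.smul_mem _ (e' i) hm
end

section
/- Polynomial interpolation under adversarial errors (equivalent form of Lemma B.1): let Q < P be positive integers, let a_0,…,a_{P−1} be pairwise distinct real numbers, and let z_0,…,z_{P−1} ∈ ℝ. If f and g are real polynomials of degree at most Q − 1 such that |{p : f(a_p) ≠ z_p}| ≤ ⌊(P−Q)/2⌋ and |{p : g(a_p) ≠ z_p}| ≤ ⌊(P−Q)/2⌋, then f = g. That is, a real polynomial with Q coefficients is determined by its evaluations at P distinct points when at most ⌊(P−Q)/2⌋ evaluations are corrupted. -/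
open Polynomial

/-- Polynomial interpolation under adversarial errors (equivalent form of Lemma B.1): a
real polynomial of degree at most `Q − 1` is determined by its evaluations at `P` distinct
points when at most `⌊(P−Q)/2⌋` evaluations are corrupted. -/
theorem stmt_11 (P Q : ℕ) (hQ : 0 < Q) (hQP : Q < P)
    (a : Fin P → ℝ) (ha : Function.Injective a) (z : Fin P → ℝ)
    (f g : Polynomial ℝ) (hf : f.degree ≤ (Q - 1 : ℕ)) (hg : g.degree ≤ (Q - 1 : ℕ))
    (hfz : (Finset.univ.filter fun p : Fin P => f.eval (a p) ≠ z p).card ≤ (P - Q) / 2)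
    (hgz : (Finset.univ.filter fun p : Fin P => g.eval (a p) ≠ z p).card ≤ (P - Q) / 2) :
    f = g := by
  classical
  set A := Finset.univ.filter fun p : Fin P => f.eval (a p) ≠ z p with hA
  set B := Finset.univ.filter fun p : Fin P => g.eval (a p) ≠ z p with hB
  have hU : (A ∪ B).card ≤ P - Q := by
    have := Finset.card_union_le A B
    omega
  have hS : Q ≤ ((A ∪ B)ᶜ).card := by
    rw [Finset.card_compl, Fintype.card_fin]
    omega
  have hlt : ((Q - 1 : ℕ) : WithBot ℕ) < (((A ∪ B)ᶜ).card : WithBot ℕ) := by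
    exact_mod_cast (by omega : Q - 1 < ((A ∪ B)ᶜ).card)
  refine Polynomial.eq_of_degrees_lt_of_eval_index_eq (v := a) (A ∪ B)ᶜ ha.injOn
    (lt_of_le_of_lt hf hlt) (lt_of_le_of_lt hg hlt) ?_
  intro p hp
  simp only [hA, hB, Finset.mem_compl, Finset.mem_union, Finset.mem_filter, Finset.mem_univ,
    true_and, not_or, not_not] at hp
  rw [hp.1, hp.2]
end

section
/- Coefficient identity and degree bound for the Generalized PolyDot backpropagation stage (core of Theorem 4, substitution v = u^m): for every j = 0,…,n−1 and every column index c ∈ {0,…,b−1}, the coefficient of u^{m−1 + m·j} in the c-th entry of c̃^T(u) = δ̃^T(u)·W̃(u) equals the c-th entry of c_j^T = ∑_{i=0}^{m−1} δ_i^T W_{i,j}; moreover every entry of c̃^T(u) has degree at most m·n + m − 2, so the backpropagation product is recoverable from m·n + m − 1 evaluations at distinct points. -/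
open Polynomial Matrix BigOperators

/-- Generalized PolyDot backpropagation encoding of `W` (after substitution `v = u^m`). -/
noncomputable def bpWTilde (m n a b : ℕ) (W : Fin m → Fin n → Matrix (Fin a) (Fin b) ℝ) :
    Matrix (Fin a) (Fin b) (Polynomial ℝ) :=
  Matrix.of fun r c => ∑ i : Fin m, ∑ j : Fin n,
    Polynomial.C (W i j r c) * Polynomial.X ^ ((i : ℕ) + m * (j : ℕ))

/-- Encoding of the partitioned backpropagated error row vector `δᵀ`. -/
noncomputable def bpDeltaTilde (m a : ℕ) (δ : Fin m → Fin a → ℝ) : Fin a → Polynomial ℝ :=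
  fun rr => ∑ i : Fin m, Polynomial.C (δ i rr) * Polynomial.X ^ (m - 1 - (i : ℕ))

/-- The product polynomial row vector `c̃ᵀ(u) = δ̃ᵀ(u)·W̃(u)`. -/
noncomputable def bpCTilde (m n a b : ℕ) (W : Fin m → Fin n → Matrix (Fin a) (Fin b) ℝ)
    (δ : Fin m → Fin a → ℝ) : Fin b → Polynomial ℝ :=
  Matrix.vecMul (bpDeltaTilde m a δ) (bpWTilde m n a b W)

theorem bpC_expand (m n a b : ℕ) (W : Fin m → Fin n → Matrix (Fin a) (Fin b) ℝ)
    (δ : Fin m → Fin a → ℝ) (c : Fin b) :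
    bpCTilde m n a b W δ c = ∑ r : Fin a, ∑ k : Fin m, ∑ i : Fin m, ∑ j : Fin n,
      Polynomial.C (δ k r * W i j r c) * Polynomial.X ^ (m - 1 - (k : ℕ) + ((i : ℕ) + m * (j : ℕ))) := by
  simp only [bpCTilde, Matrix.vecMul, dotProduct, bpDeltaTilde, bpWTilde, Matrix.of_apply]
  refine Finset.sum_congr rfl fun r _ => ?_
  rw [Finset.sum_mul]
  refine Finset.sum_congr rfl fun k _ => ?_
  rw [Finset.mul_sum]
  refine Finset.sum_congr rfl fun i _ => ?_
  rw [Finset.mul_sum]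
  refine Finset.sum_congr rfl fun j _ => ?_
  rw [Polynomial.C_mul, pow_add]
  ring

theorem bp_exp_iff (m n : ℕ) (k i : Fin m) (j j' : Fin n) :
    (m - 1 + m * (j : ℕ) = m - 1 - (k : ℕ) + ((i : ℕ) + m * (j' : ℕ))) ↔ (k = i ∧ j = j') := by
  have hk := k.isLt
  have hi := i.isLt
  constructor
  · intro h
    have h1 : (k : ℕ) + m * (j : ℕ) = i + m * (j' : ℕ) := by omega
    have hm : 0 < m := by omega
    have h2 := congrArg (· % m) h1
    have h3 := congrArg (· / m) h1
    simp only [Nat.add_mul_mod_self_left, Nat.mod_eq_of_lt hk, Nat.mod_eq_of_lt hi] at h2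
    simp only [Nat.add_mul_div_left _ _ hm, Nat.div_eq_of_lt hk, Nat.div_eq_of_lt hi,
      zero_add] at h3
    exact ⟨Fin.ext h2, Fin.ext h3⟩
  · rintro ⟨rfl, rfl⟩
    omega

/-- Coefficient identity and degree bound for the Generalized PolyDot backpropagation
stage (core of Theorem 4, substitution `v = u^m`): the coefficient of `u^(m−1+m·j)` in the
`c`-th entry of `c̃ᵀ(u)` equals the `c`-th entry of `c_jᵀ = ∑_i δ_iᵀ W_{i,j}`, and every
entry of `c̃ᵀ(u)` has degree at most `m·n + m − 2`. -/
theorem stmt_16 (m n a b : ℕ) (hm : 0 < m) (hn : 0 < n) (ha : 0 < a) (hb : 0 < b)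
    (W : Fin m → Fin n → Matrix (Fin a) (Fin b) ℝ) (δ : Fin m → Fin a → ℝ) :
    (∀ (j : Fin n) (c : Fin b),
        (bpCTilde m n a b W δ c).coeff (m - 1 + m * (j : ℕ))
          = (∑ i : Fin m, Matrix.vecMul (δ i) (W i j)) c)
    ∧ (∀ c : Fin b, (bpCTilde m n a b W δ c).degree ≤ (m * n + m - 2 : ℕ)) := by
  constructor
  · intro j c
    rw [bpC_expand]
    simp only [Polynomial.finset_sum_coeff, Polynomial.coeff_C_mul, Polynomial.coeff_X_pow,
      bp_exp_iff, ite_and, mul_ite, mul_one, mul_zero, Finset.sum_apply, Matrix.vecMul, dotProduct]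
    rw [Finset.sum_comm]
    refine Finset.sum_congr rfl fun k _ => ?_
    refine Finset.sum_congr rfl fun r _ => ?_
    rw [Finset.sum_eq_single k]
    · simp
    · intro i _ hi
      simp [Ne.symm hi]
    · simp
  · intro c
    rw [bpC_expand]
    refine (Polynomial.mem_degreeLE).1 ?_
    refine Submodule.sum_mem _ fun r _ => Submodule.sum_mem _ fun k _ =>
      Submodule.sum_mem _ fun i _ => Submodule.sum_mem _ fun j _ => ?_
    rw [Polynomial.mem_degreeLE]
    refine (Polynomial.degree_C_mul_X_pow_le _ _).trans ?_
    have hi := i.isLt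
    have hj : m * (j : ℕ) + m ≤ m * n := by
      have := Nat.mul_le_mul_left m (Nat.succ_le_of_lt j.isLt)
      simpa [Nat.mul_succ] using this
    exact_mod_cast (by omega : m - 1 - (k : ℕ) + ((i : ℕ) + m * (j : ℕ)) ≤ m * n + m - 2)
end

section
/- MatDot coefficient identity and degree bound (special case of Generalized PolyDot with m = d = 1, n = K): let K ≥ 1, let W_0,…,W_{K−1} ∈ ℝ^{a×b} be the vertical blocks of W and X_0,…,X_{K−1} ∈ ℝ^{b×c} the horizontal blocks of X, and define W̃(v) := ∑_{i=0}^{K−1} W_i v^i and X̃(v) := ∑_{j=0}^{K−1} X_j v^{K−1−j} over ℝ[v], with S̃(v) := W̃(v)·X̃(v). Then the coefficient of v^{K−1} in every entry of S̃(v) equals the corresponding entry of ∑_{i=0}^{K−1} W_i X_i = W X, and every entry of S̃(v) has degree at most 2K − 2; hence the product W X is recoverable from evaluations of S̃ at any 2K − 1 distinct points. -/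
open Polynomial Matrix BigOperators

/-- MatDot encoding of the vertical blocks of `W`. -/
noncomputable def mdWTilde (K a b : ℕ) (W : Fin K → Matrix (Fin a) (Fin b) ℝ) :
    Matrix (Fin a) (Fin b) (Polynomial ℝ) :=
  Matrix.of fun r c => ∑ i : Fin K, Polynomial.C (W i r c) * Polynomial.X ^ (i : ℕ)

/-- MatDot encoding of the horizontal blocks of `X`. -/
noncomputable def mdXTilde (K b c : ℕ) (X : Fin K → Matrix (Fin b) (Fin c) ℝ) :
    Matrix (Fin b) (Fin c) (Polynomial ℝ) :=
  Matrix.of fun r s => ∑ j : Fin K, Polynomial.C (X j r s) * Polynomial.X ^ (K - 1 - (j : ℕ))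

/-- MatDot coefficient identity and degree bound (special case of Generalized PolyDot with
`m = d = 1`, `n = K`): the coefficient of `v^(K−1)` in every entry of
`S̃(v) = W̃(v)·X̃(v)` equals the corresponding entry of `∑_i W_i X_i = W X`, and every
entry of `S̃(v)` has degree at most `2K − 2`. -/
theorem stmt_19 (K a b c : ℕ) (hK : 1 ≤ K) (ha : 0 < a) (hb : 0 < b) (hc : 0 < c)
    (W : Fin K → Matrix (Fin a) (Fin b) ℝ) (X : Fin K → Matrix (Fin b) (Fin c) ℝ) :
    (∀ (r : Fin a) (s : Fin c),
        ((mdWTilde K a b W * mdXTilde K b c X) r s).coeff (K - 1)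
          = (∑ i : Fin K, W i * X i) r s)
    ∧ (∀ (r : Fin a) (s : Fin c),
        ((mdWTilde K a b W * mdXTilde K b c X) r s).degree ≤ (2 * K - 2 : ℕ)) := by
  have key : ∀ (r : Fin a) (s : Fin c), (mdWTilde K a b W * mdXTilde K b c X) r s
      = ∑ k : Fin b, ∑ i : Fin K, ∑ j : Fin K,
          Polynomial.C (W i r k * X j k s) * Polynomial.X ^ ((i : ℕ) + (K - 1 - (j : ℕ))) := by
    intro r s
    simp only [Matrix.mul_apply, mdWTilde, mdXTilde, Matrix.of_apply, Finset.sum_mul_sum]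
    refine Finset.sum_congr rfl fun k _ => Finset.sum_congr rfl fun i _ =>
      Finset.sum_congr rfl fun j _ => ?_
    rw [Polynomial.C_mul, pow_add]
    ring
  refine ⟨fun r s => ?_, fun r s => ?_⟩
  · rw [key, Matrix.sum_apply]
    simp only [Polynomial.finsetSum_coeff, Polynomial.coeff_C_mul_X_pow, Matrix.mul_apply]
    rw [Finset.sum_comm]
    refine Finset.sum_congr rfl fun i _ => Finset.sum_congr rfl fun k _ => ?_
    rw [Finset.sum_eq_single i]
    · rw [if_pos]
      omega
    · intro j _ hj
      rw [if_neg]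
      intro h
      apply hj
      ext
      omega
    · simp
  · rw [key]
    rw [← Polynomial.mem_degreeLE]
    refine Submodule.sum_mem _ fun k _ => Submodule.sum_mem _ fun i _ =>
      Submodule.sum_mem _ fun j _ => ?_
    rw [Polynomial.mem_degreeLE]
    refine (Polynomial.degree_C_mul_X_pow_le _ _).trans ?_
    exact_mod_cast (by omega : (i : ℕ) + (K - 1 - (j : ℕ)) ≤ 2 * K - 2)
end
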